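/- (Fixed-point characterization of the Augustin mean, α < 1.) Let α ∈ (0,1) and suppose the positive definite d×d density matrix u satisfies the fixed-point equation u = Σ_i P(i)·(u^{(1−α)/2} W_i^α u^{(1−α)/2}) / Tr[u^{(1−α)/2} W_i^α u^{(1−α)/2}]. Then for every positive definite d×d density matrix τ: Σ_i P(i)·D_α(W_i‖τ) ≥ Σ_i P(i)·D_α(W_i‖u) + D_α(u‖τ). In particular, u attains the infimum defining I^{(2)}_α(P,W), i.e., I^{(2)}_α(P,W) = Σ_i P(i)·D_α(W_i‖u). -/

import Mathlib

open Matrix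
open scoped ComplexOrder

/-- Real power of a (hermitian) matrix via the continuous functional calculus. -/
noncomputable def mpow {ι : Type*} [Fintype ι] [DecidableEq ι]
    (A : Matrix ι ι ℂ) (r : ℝ) : Matrix ι ι ℂ :=
  cfc (fun x : ℝ => x ^ r) A

/-- Logarithm of a (hermitian) matrix via the continuous functional calculus. -/
noncomputable def mlog {ι : Type*} [Fintype ι] [DecidableEq ι]
    (A : Matrix ι ι ℂ) : Matrix ι ι ℂ :=
  cfc Real.log A

/-- Real part of the trace. -/
noncomputable def trR {ι : Type*} [Fintype ι] (A : Matrix ι ι ℂ) : ℝ :=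
  (Matrix.trace A).re

/-- Positive definite density matrices. -/
def Dens (d : ℕ) : Type :=
  {σ : Matrix (Fin d) (Fin d) ℂ // σ.PosDef ∧ σ.trace = 1}

/-- Petz Rényi divergence of order `α ≠ 1`. -/
noncomputable def Dpetz {d : ℕ} (α : ℝ) (ρ σ : Matrix (Fin d) (Fin d) ℂ) : ℝ :=
  (1 / (α - 1)) * Real.log (trR (mpow ρ α * mpow σ (1 - α)))

/-- Petz Augustin information (order `α ≠ 1`). -/
noncomputable def augustinInfo {d n : ℕ} (α : ℝ) (W : Fin n → Matrix (Fin d) (Fin d) ℂ)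
    (P : Fin n → ℝ) : ℝ :=
  ⨅ σ : Dens d, ∑ i, P i * Dpetz α (W i) σ.1

section MatrixPowers

variable {ι : Type*} [Fintype ι] [DecidableEq ι]

/-- The trace of a product of functions of two hermitian matrices is a nonnegative combination of
products of values at the eigenvalues, with weights independent of the functions. -/
lemma exists_trR_cfc_mul_cfc_eq_sum {A B : Matrix ι ι ℂ} (hA : A.IsHermitian)
    (hB : B.IsHermitian) :
    ∃ w : ι → ι → ℝ, (∀ i j, 0 ≤ w i j) ∧ ∀ f g : ℝ → ℝ,
      trR (cfc f A * cfc g B) =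
        ∑ i, ∑ j, f (hA.eigenvalues i) * g (hB.eigenvalues j) * w i j := by
  set U : Matrix ι ι ℂ := hA.eigenvectorUnitary.1
  set V : Matrix ι ι ℂ := hB.eigenvectorUnitary.1
  refine ⟨fun i j => Complex.normSq ((star U * V) i j), fun i j => Complex.normSq_nonneg _, ?_⟩
  intro f g
  rw [hA.cfc_eq, hB.cfc_eq, Matrix.IsHermitian.cfc, Matrix.IsHermitian.cfc,
    Unitary.conjStarAlgAut_apply, Unitary.conjStarAlgAut_apply]
  change trR (U * diagonal _ * star U * (V * diagonal _ * star V)) = _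
  set D : Matrix ι ι ℂ := diagonal (RCLike.ofReal ∘ f ∘ hA.eigenvalues) with hD
  set E : Matrix ι ι ℂ := diagonal (RCLike.ofReal ∘ g ∘ hB.eigenvalues) with hE
  have h : (U * D * star U * (V * E * star V)).trace
      = (D * (star U * V) * (E * star (star U * V))).trace := by
    rw [show U * D * star U * (V * E * star V) = U * (D * star U * (V * E * star V)) by
      simp only [mul_assoc], trace_mul_comm]
    simp only [mul_assoc, star_mul, star_star]
  rw [trR, h, trace, Complex.re_sum]
  refine Finset.sum_congr rfl fun i _ => ?_
  rw [diag_apply, mul_apply, Complex.re_sum]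
  refine Finset.sum_congr rfl fun j _ => ?_
  rw [hD, hE, diagonal_mul, diagonal_mul, star_apply]
  have hz : ∀ z : ℂ, ∀ a b : ℝ, ((a : ℂ) * z * (b * star z)).re = a * b * Complex.normSq z := by
    intro z a b
    rw [Complex.normSq_apply]
    simp
    ring
  exact hz _ _ _

lemma trR_mpow_mul_mpow_pos [Nonempty ι] {A B : Matrix ι ι ℂ} (hA : A.PosDef) (hB : B.PosDef)
    (r t : ℝ) : 0 < trR (mpow A r * mpow B t) := by
  obtain ⟨w, hw, h⟩ := exists_trR_cfc_mul_cfc_eq_sum hA.1 hB.1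
  have hwsum : 0 < ∑ i, ∑ j, w i j := by
    have h1 := h (fun _ => 1) (fun _ => 1)
    rw [cfc_const_one ℝ A hA.1.isSelfAdjoint, cfc_const_one ℝ B hB.1.isSelfAdjoint] at h1
    simp only [mul_one, one_mul] at h1
    rw [← h1]
    simp [trR, trace_one, Fintype.card_pos]
  rw [mpow, mpow, h]
  have hc : ∀ i j, 0 < hA.1.eigenvalues i ^ r * hB.1.eigenvalues j ^ t := fun i j =>
    mul_pos (Real.rpow_pos_of_pos (hA.eigenvalues_pos i) _)
      (Real.rpow_pos_of_pos (hB.eigenvalues_pos j) _)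
  rw [← Finset.sum_product'] at hwsum ⊢
  obtain ⟨p, hp, hpw⟩ := Finset.exists_lt_of_sum_lt (by simpa using hwsum :
    ∑ _p ∈ Finset.univ ×ˢ Finset.univ, (0 : ℝ) < ∑ p ∈ Finset.univ ×ˢ Finset.univ, w p.1 p.2)
  exact Finset.sum_pos' (fun q _ => mul_nonneg (hc q.1 q.2).le (hw q.1 q.2))
    ⟨p, hp, mul_pos (hc p.1 p.2) hpw⟩

/-- Young's inequality for the trace of a product of matrix powers. -/
lemma trR_mpow_mul_mpow_le {A B : Matrix ι ι ℂ} (hA : A.PosDef) (hB : B.PosDef)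
    {α : ℝ} (h0 : 0 ≤ α) (h1 : α ≤ 1) :
    trR (mpow A α * mpow B (1 - α)) ≤ α * trR A + (1 - α) * trR B := by
  obtain ⟨w, hw, h⟩ := exists_trR_cfc_mul_cfc_eq_sum hA.1 hB.1
  have hAt := h (fun x => x) (fun _ => 1)
  have hBt := h (fun _ => 1) (fun x => x)
  rw [cfc_id' ℝ A hA.1.isSelfAdjoint, cfc_const_one ℝ B hB.1.isSelfAdjoint, mul_one] at hAt
  rw [cfc_id' ℝ B hB.1.isSelfAdjoint, cfc_const_one ℝ A hA.1.isSelfAdjoint, one_mul] at hBt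
  rw [mpow, mpow, h, hAt, hBt, Finset.mul_sum, Finset.mul_sum, ← Finset.sum_add_distrib]
  refine Finset.sum_le_sum fun i _ => ?_
  rw [Finset.mul_sum, Finset.mul_sum, ← Finset.sum_add_distrib]
  refine Finset.sum_le_sum fun j _ => ?_
  have := mul_le_mul_of_nonneg_right (Real.geom_mean_le_arith_mean2_weighted h0
    (sub_nonneg.2 h1) (hA.eigenvalues_pos i).le (hB.eigenvalues_pos j).le (by ring)) (hw i j)
  linarith

lemma mpow_mul_mpow {A : Matrix ι ι ℂ} (hA : A.PosDef) (r t : ℝ) :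
    mpow A r * mpow A t = mpow A (r + t) := by
  have hfin : (spectrum ℝ A).Finite := by
    rw [hA.1.spectrum_real_eq_range_eigenvalues]
    exact Set.finite_range _
  rw [mpow, mpow, ← cfc_mul _ _ _ (hfin.continuousOn _) (hfin.continuousOn _), mpow]
  refine cfc_congr fun x hx => ?_
  rw [hA.1.spectrum_real_eq_range_eigenvalues] at hx
  obtain ⟨i, rfl⟩ := hx
  exact (Real.rpow_add (hA.eigenvalues_pos i) r t).symm

lemma mpow_zero {A : Matrix ι ι ℂ} (hA : A.PosDef) : mpow A 0 = 1 := by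
  simp only [mpow, Real.rpow_zero]
  exact cfc_const_one ℝ A hA.1.isSelfAdjoint

lemma mpow_one {A : Matrix ι ι ℂ} (hA : A.PosDef) : mpow A 1 = A := by
  simp only [mpow, Real.rpow_one]
  exact cfc_id' ℝ A hA.1.isSelfAdjoint

lemma trR_mpow_half_conj {A : Matrix ι ι ℂ} (hA : A.PosDef) (B : Matrix ι ι ℂ) (s : ℝ) :
    trR (mpow A (s / 2) * B * mpow A (s / 2)) = trR (B * mpow A s) := by
  rw [trR, trR, mul_assoc, trace_mul_comm, mul_assoc, mpow_mul_mpow hA, add_halves]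

end MatrixPowers

lemma trR_sum_smul_mul {ι κ : Type*} [Fintype ι] [Fintype κ] (c : κ → ℝ)
    (M : κ → Matrix ι ι ℂ) (B : Matrix ι ι ℂ) :
    trR ((∑ i, c i • M i) * B) = ∑ i, c i * trR (M i * B) := by
  simp [trR, Finset.sum_mul, trace_sum, trace_smul]

/-- Conjugating the fixed-point equation by `u ^ (-(1 - α) / 2)` linearizes it. -/
lemma mpow_eq_sum_of_fixed_point {ι κ : Type*} [Fintype ι] [DecidableEq ι] [Fintype κ]
    {u : Matrix ι ι ℂ} (hu : u.PosDef) (s : ℝ) (c : κ → ℝ) (M : κ → Matrix ι ι ℂ)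
    (h : u = ∑ i, c i • (mpow u (s / 2) * M i * mpow u (s / 2))) :
    mpow u (1 - s) = ∑ i, c i • M i := by
  have hl : mpow u (-(s / 2)) * mpow u (s / 2) = 1 := by
    rw [mpow_mul_mpow hu, neg_add_cancel, mpow_zero hu]
  have hr : mpow u (s / 2) * mpow u (-(s / 2)) = 1 := by
    rw [mpow_mul_mpow hu, add_neg_cancel, mpow_zero hu]
  calc mpow u (1 - s) = mpow u (-(s / 2)) * u * mpow u (-(s / 2)) := by
        conv_rhs => enter [1, 2]; rw [← mpow_one hu]
        rw [mpow_mul_mpow hu, mpow_mul_mpow hu]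
        congr 1
        ring
    _ = mpow u (-(s / 2)) * (∑ i, c i • (mpow u (s / 2) * M i * mpow u (s / 2))) *
          mpow u (-(s / 2)) := by rw [← h]
    _ = ∑ i, c i • M i := by
        rw [Finset.mul_sum, Finset.sum_mul]
        refine Finset.sum_congr rfl fun i _ => ?_
        rw [mul_smul_comm, smul_mul_assoc, mul_assoc, mul_assoc, mul_assoc, hr, mul_one,
          ← mul_assoc, hl, one_mul]

lemma Dpetz_nonneg {d : ℕ} [NeZero d] {α : ℝ} (hα : α ∈ Set.Ioo (0 : ℝ) 1)
    {ρ σ : Matrix (Fin d) (Fin d) ℂ} (hρ : ρ.PosDef) (hρ1 : ρ.trace = 1)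
    (hσ : σ.PosDef) (hσ1 : σ.trace = 1) : 0 ≤ Dpetz α ρ σ := by
  have hle := trR_mpow_mul_mpow_le hρ hσ hα.1.le hα.2.le
  rw [show trR ρ = 1 by simp [trR, hρ1], show trR σ = 1 by simp [trR, hσ1]] at hle
  refine mul_nonneg_of_nonpos_of_nonpos
    (one_div_nonpos.2 (by linarith [hα.2])) (Real.log_nonpos ?_ (by linarith))
  exact (trR_mpow_mul_mpow_pos hρ hσ _ _).le

/-- fixed-point characterization of the Augustin mean for `α ∈ (0,1)`. -/
theorem augustin_mean_fixed_point_lt_one {d n : ℕ} (hd : 0 < d) (hn : 0 < n)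
    (W : Fin n → Matrix (Fin d) (Fin d) ℂ)
    (hW : ∀ i, (W i).PosDef ∧ (W i).trace = 1)
    (P : Fin n → ℝ) (hP : ∀ i, 0 ≤ P i) (hP1 : ∑ i, P i = 1)
    (α : ℝ) (hα : α ∈ Set.Ioo (0 : ℝ) 1)
    (u : Matrix (Fin d) (Fin d) ℂ) (hu : u.PosDef) (hu1 : u.trace = 1)
    (hfix : u = ∑ i,
      (P i / trR (mpow u ((1 - α) / 2) * mpow (W i) α * mpow u ((1 - α) / 2))) •
        (mpow u ((1 - α) / 2) * mpow (W i) α * mpow u ((1 - α) / 2))) :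
    (∀ τ : Matrix (Fin d) (Fin d) ℂ, τ.PosDef → τ.trace = 1 →
      ∑ i, P i * Dpetz α (W i) u + Dpetz α u τ ≤ ∑ i, P i * Dpetz α (W i) τ) ∧
    augustinInfo α W P = ∑ i, P i * Dpetz α (W i) u := by
  have : NeZero d := ⟨hd.ne'⟩
  obtain ⟨hα0, hα1⟩ := hα
  set c : Fin n → ℝ := fun i => trR (mpow (W i) α * mpow u (1 - α)) with hc
  have hcpos : ∀ i, 0 < c i := fun i => trR_mpow_mul_mpow_pos (hW i).1 hu _ _
  have hlin : mpow u α = ∑ i, (P i / c i) • mpow (W i) α := by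
    have h := mpow_eq_sum_of_fixed_point hu (1 - α) _ _ hfix
    simpa only [sub_sub_cancel, trR_mpow_half_conj hu] using h
  have key : ∀ τ : Matrix (Fin d) (Fin d) ℂ, τ.PosDef → τ.trace = 1 →
      ∑ i, P i * Dpetz α (W i) u + Dpetz α u τ ≤ ∑ i, P i * Dpetz α (W i) τ := by
    intro τ hτ _
    set t : Fin n → ℝ := fun i => trR (mpow (W i) α * mpow τ (1 - α)) with ht
    have htpos : ∀ i, 0 < t i := fun i => trR_mpow_mul_mpow_pos (hW i).1 hτ _ _
    have hsum : trR (mpow u α * mpow τ (1 - α)) = ∑ i, P i * (t i / c i) := by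
      rw [hlin, trR_sum_smul_mul]
      exact Finset.sum_congr rfl fun i _ => by ring
    have hjensen : ∑ i, P i * Real.log (t i / c i) ≤ Real.log (∑ i, P i * (t i / c i)) :=
      strictConcaveOn_log_Ioi.concaveOn.le_map_sum (fun i _ => hP i) hP1
        (fun i _ => div_pos (htpos i) (hcpos i))
    have hdiff : ∑ i, P i * Dpetz α (W i) τ - ∑ i, P i * Dpetz α (W i) u
        = (1 / (α - 1)) * ∑ i, P i * Real.log (t i / c i) := by
      rw [← Finset.sum_sub_distrib, Finset.mul_sum]
      refine Finset.sum_congr rfl fun i _ => ?_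
      rw [Real.log_div (htpos i).ne' (hcpos i).ne', Dpetz, Dpetz]
      ring
    have hmul := mul_le_mul_of_nonpos_left hjensen
      (one_div_nonpos.2 (sub_nonpos.2 hα1.le) : 1 / (α - 1) ≤ 0)
    rw [← hsum, ← hdiff] at hmul
    rw [show Dpetz α u τ = 1 / (α - 1) * Real.log (trR (mpow u α * mpow τ (1 - α))) from rfl]
    linarith
  have hmin : ∀ σ : Dens d, ∑ i, P i * Dpetz α (W i) u ≤ ∑ i, P i * Dpetz α (W i) σ.1 :=
    fun σ => by
      linarith [key σ.1 σ.2.1 σ.2.2, Dpetz_nonneg ⟨hα0, hα1⟩ hu hu1 σ.2.1 σ.2.2]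
  refine ⟨key, le_antisymm ?_ ?_⟩
  · exact ciInf_le ⟨_, Set.forall_mem_range.2 hmin⟩ (⟨u, hu, hu1⟩ : Dens d)
  · have : Nonempty (Dens d) := ⟨⟨u, hu, hu1⟩⟩
    exact le_ciInf hmin
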